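/- arXiv:2408.06035 — 3 statements merged into one kernel-verified Lean document; each statement's English description precedes it below -/
import Mathlib

section
/- (Proposition on iterative repair.) Let φ be a HyperLTL formula and P, Q, S terminating programs with SymPaths_max(P), SymPaths_max(S), and SymPaths_max(Q) finite. Then Q is a better repair than S with respect to (P, φ) if and only if the formula enc^φ_{SymPaths_max(Q)} ∧ iter_{SymPaths_max(P), SymPaths_max(S), SymPaths_max(Q)} is valid. -/
namespace HyRep

/-- A (concrete) store maps program variables to integers. -/
abbrev Store (X : Type) := X → ℤ

/-- Programs of the simple while-language (with shallowly embedded integer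
and Boolean expressions over the variables `X`). -/
inductive Prog (X : Type) : Type where
  | skip : Prog X
  | assign (x : X) (e : Store X → ℤ) : Prog X
  | ite (b : Store X → Bool) (p q : Prog X) : Prog X
  | whileLoop (b : Store X → Bool) (p : Prog X) : Prog X
  | seq (p q : Prog X) : Prog X
  | observe : Prog X

/-- A configuration is a program together with a store. -/
abbrev Config (X : Type) := Prog X × Store X

/-- The labelled small-step semantics: the label `none` is the silent label ε,
while `some σ` is the observation of the store `σ` (emitted by `observe`). -/
inductive Step {X : Type} [DecidableEq X] :
    Config X → Option (Store X) → Config X → Prop where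
  | assign {x : X} {e : Store X → ℤ} {σ : Store X} :
      Step (.assign x e, σ) none (.skip, Function.update σ x (e σ))
  | observe {σ : Store X} : Step (.observe, σ) (some σ) (.skip, σ)
  | iteTrue {b : Store X → Bool} {p q : Prog X} {σ : Store X} (h : b σ = true) :
      Step (.ite b p q, σ) none (p, σ)
  | iteFalse {b : Store X → Bool} {p q : Prog X} {σ : Store X} (h : b σ = false) :
      Step (.ite b p q, σ) none (q, σ)
  | whileTrue {b : Store X → Bool} {p : Prog X} {σ : Store X} (h : b σ = true) :
      Step (.whileLoop b p, σ) none (.seq p (.whileLoop b p), σ)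
  | whileFalse {b : Store X → Bool} {p : Prog X} {σ : Store X} (h : b σ = false) :
      Step (.whileLoop b p, σ) none (.skip, σ)
  | seqSkip {p : Prog X} {σ : Store X} : Step (.seq .skip p, σ) none (p, σ)
  | seqStep {p p' q : Prog X} {σ σ' : Store X} {μ : Option (Store X)}
      (h : Step (p, σ) μ (p', σ')) : Step (.seq p q, σ) μ (.seq p' q, σ')

/-- An execution from configuration `C`: a (finite or infinite) sequence of
labelled small steps.  `len : ℕ∞` is the number of steps; `cfg i` is the `i`-th
configuration and `lbl i` the label of the step from `cfg i` to `cfg (i+1)`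
(the values of `cfg`/`lbl` beyond `len` are irrelevant). -/
structure Exec {X : Type} [DecidableEq X] (C : Config X) where
  len : ℕ∞
  cfg : ℕ → Config X
  lbl : ℕ → Option (Store X)
  init : cfg 0 = C
  step : ∀ i : ℕ, (i : ℕ∞) + 1 ≤ len → Step (cfg i) (lbl i) (cfg (i + 1))

/-- An execution is maximal if it is infinite or ends in a configuration whose
program component is `skip`. -/
def Exec.Maximal {X : Type} [DecidableEq X] {C : Config X} (ρ : Exec C) : Prop :=
  ρ.len = ⊤ ∨ ∃ n : ℕ, ρ.len = (n : ℕ∞) ∧ (ρ.cfg n).1 = Prog.skip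

/-- The indices (within the length of the execution) at which an observation
(a non-ε label) is emitted. -/
def Exec.ObsIdx {X : Type} [DecidableEq X] {C : Config X} (ρ : Exec C) : ℕ → Prop :=
  fun i => (i : ℕ∞) + 1 ≤ ρ.len ∧ (ρ.lbl i).isSome

/-- A (finite or infinite) trace: a sequence of stores of length `len`
(values of `get` beyond `len` are irrelevant). -/
structure Trace (X : Type) where
  len : ℕ∞
  get : ℕ → Store X

open Classical in
/-- The observation sequence of an execution: the sequence of observed stores,
obtained by removing all ε labels. -/
noncomputable def Exec.obs {X : Type} [DecidableEq X] {C : Config X}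
    (ρ : Exec C) : Trace X where
  len := if h : {i | ρ.ObsIdx i}.Finite then (h.toFinset.card : ℕ∞) else ⊤
  get := fun k => (ρ.lbl (Nat.nth ρ.ObsIdx k)).getD (fun _ => 0)

open Classical in
/-- The observation sequence `obs(P, σ)` along the (unique) maximal execution
from `⟨P, σ⟩`. -/
noncomputable def obsTrace {X : Type} [DecidableEq X] (P : Prog X) (σ : Store X) :
    Trace X :=
  if h : ∃ ρ : Exec (P, σ), ρ.Maximal then h.choose.obs else ⟨0, fun _ _ => 0⟩

/-- `Traces(P)`: the set of observation sequences of maximal executions of `P`. -/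
def Traces {X : Type} [DecidableEq X] (P : Prog X) : Set (Trace X) :=
  { t | ∃ (σ : Store X) (ρ : Exec (P, σ)), ρ.Maximal ∧ t = ρ.obs }

/-- A program is terminating if all of its (maximal) executions are finite. -/
def Terminating {X : Type} [DecidableEq X] (P : Prog X) : Prop :=
  ∀ (σ : Store X) (ρ : Exec (P, σ)), ρ.Maximal → ∃ n : ℕ, ρ.len = (n : ℕ∞)

/-! ### Symbolic execution -/

/-- A symbolic store maps each variable to an (integer) expression over `X`. -/
abbrev SymStore (X : Type) := X → Store X → ℤ

/-- A path condition: a first-order condition on stores. -/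
abbrev PathCond (X : Type) := Store X → Prop

/-- Symbolic configurations `⟨P, ν, α, β⟩`. -/
abbrev SymConfig (X : Type) := Prog X × SymStore X × PathCond X × List (SymStore X)

/-- Substitute the symbolic store `ν` into the integer expression `e`. -/
def symEvalA {X : Type} (e : Store X → ℤ) (ν : SymStore X) : Store X → ℤ :=
  fun σ => e fun x => ν x σ

/-- Substitute the symbolic store `ν` into the Boolean expression `b`. -/
def symEvalB {X : Type} (b : Store X → Bool) (ν : SymStore X) : Store X → Bool :=
  fun σ => b fun x => ν x σ

/-- Small-step symbolic execution. -/
inductive SymStep {X : Type} [DecidableEq X] : SymConfig X → SymConfig X → Prop where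
  | assign {x : X} {e : Store X → ℤ} {ν : SymStore X} {α : PathCond X}
      {β : List (SymStore X)} :
      SymStep (.assign x e, ν, α, β) (.skip, Function.update ν x (symEvalA e ν), α, β)
  | observe {ν : SymStore X} {α : PathCond X} {β : List (SymStore X)} :
      SymStep (.observe, ν, α, β) (.skip, ν, α, β ++ [ν])
  | iteTrue {b : Store X → Bool} {p q : Prog X} {ν : SymStore X} {α : PathCond X}
      {β : List (SymStore X)} :
      SymStep (.ite b p q, ν, α, β) (p, ν, fun σ => α σ ∧ symEvalB b ν σ = true, β)
  | iteFalse {b : Store X → Bool} {p q : Prog X} {ν : SymStore X} {α : PathCond X}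
      {β : List (SymStore X)} :
      SymStep (.ite b p q, ν, α, β) (q, ν, fun σ => α σ ∧ symEvalB b ν σ = false, β)
  | whileTrue {b : Store X → Bool} {p : Prog X} {ν : SymStore X} {α : PathCond X}
      {β : List (SymStore X)} :
      SymStep (.whileLoop b p, ν, α, β)
        (.seq p (.whileLoop b p), ν, fun σ => α σ ∧ symEvalB b ν σ = true, β)
  | whileFalse {b : Store X → Bool} {p : Prog X} {ν : SymStore X} {α : PathCond X}
      {β : List (SymStore X)} :
      SymStep (.whileLoop b p, ν, α, β) (.skip, ν, fun σ => α σ ∧ symEvalB b ν σ = false, β)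
  | seqSkip {p : Prog X} {ν : SymStore X} {α : PathCond X} {β : List (SymStore X)} :
      SymStep (.seq .skip p, ν, α, β) (p, ν, α, β)
  | seqStep {p p' q : Prog X} {ν ν' : SymStore X} {α α' : PathCond X}
      {β β' : List (SymStore X)} (h : SymStep (p, ν, α, β) (p', ν', α', β')) :
      SymStep (.seq p q, ν, α, β) (.seq p' q, ν', α', β')

/-- The initial symbolic store `ν₀`, mapping each variable to itself. -/
def initSym {X : Type} : SymStore X := fun x σ => σ x

/-- A symbolic path: a path condition together with a symbolic observation sequence. -/
abbrev SymPath (X : Type) := PathCond X × List (SymStore X)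

/-- `(α, β)` is a symbolic path of `P`: it is reached by some finite symbolic
execution starting from `⟨P, ν₀, true, ε⟩`. -/
def IsSymPath {X : Type} [DecidableEq X] (P : Prog X) (p : SymPath X) : Prop :=
  ∃ (P' : Prog X) (ν : SymStore X),
    Relation.ReflTransGen SymStep (P, initSym, fun _ => True, []) (P', ν, p.1, p.2)

/-- `(α, β)` is a maximal symbolic path of `P`: the reached program is `skip`. -/
def IsMaxSymPath {X : Type} [DecidableEq X] (P : Prog X) (p : SymPath X) : Prop :=
  ∃ ν : SymStore X,
    Relation.ReflTransGen SymStep (P, initSym, fun _ => True, []) (.skip, ν, p.1, p.2)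

/-- `SymPaths(P)`: all satisfiable symbolic paths of `P`. -/
def SymPaths {X : Type} [DecidableEq X] (P : Prog X) : Set (SymPath X) :=
  { p | IsSymPath P p ∧ ∃ σ : Store X, p.1 σ }

/-- `SymPaths_max(P)`: all satisfiable maximal symbolic paths of `P`. -/
def SymPathsMax {X : Type} [DecidableEq X] (P : Prog X) : Set (SymPath X) :=
  { p | IsMaxSymPath P p ∧ ∃ σ : Store X, p.1 σ }

/-- Evaluate a symbolic observation sequence at a concrete store,
yielding a concrete observation sequence (a list of stores). -/
def evalObs {X : Type} (β : List (SymStore X)) (σ : Store X) : List (Store X) :=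
  β.map fun ν x => ν x σ

/-- Evaluate a symbolic observation sequence at a concrete store, as a trace. -/
def evalTrace {X : Type} (β : List (SymStore X)) (σ : Store X) : Trace X :=
  ⟨(β.length : ℕ∞), fun i x => (β.getD i initSym) x σ⟩

/-! ### HyperLTL -/

/-- Bodies of HyperLTL formulas over `n` trace variables: atoms are (shallowly
embedded) first-order predicates over the indexed variables `x_{π_j}` (i.e.,
predicates over one store per trace variable); negation occurs only inside
atoms, and the temporal operators are next `X` and weak-until `W`. -/
inductive LTLBody (X : Type) : ℕ → Type 1 where
  | atom {n : ℕ} (θ : (Fin n → Store X) → Prop) : LTLBody X n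
  | and {n : ℕ} (ψ₁ ψ₂ : LTLBody X n) : LTLBody X n
  | or {n : ℕ} (ψ₁ ψ₂ : LTLBody X n) : LTLBody X n
  | next {n : ℕ} (ψ : LTLBody X n) : LTLBody X n
  | wuntil {n : ℕ} (ψ₁ ψ₂ : LTLBody X n) : LTLBody X n

/-- Vacuous satisfaction: some bound trace is shorter than the current position. -/
def vac {X : Type} {n : ℕ} (Tr : Fin n → Trace X) (i : ℕ) : Prop :=
  ∃ j : Fin n, (Tr j).len ≤ (i : ℕ∞)

/-- Satisfaction `Π, i ⊨ ψ` of an LTL body on a trace assignment `Tr`. -/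
def BodySat {X : Type} {n : ℕ} (Tr : Fin n → Trace X) : LTLBody X n → ℕ → Prop
  | .atom θ => fun i => vac Tr i ∨ θ fun j => (Tr j).get i
  | .and ψ₁ ψ₂ => fun i => vac Tr i ∨ (BodySat Tr ψ₁ i ∧ BodySat Tr ψ₂ i)
  | .or ψ₁ ψ₂ => fun i => vac Tr i ∨ (BodySat Tr ψ₁ i ∨ BodySat Tr ψ₂ i)
  | .next ψ => fun i => vac Tr i ∨ BodySat Tr ψ (i + 1)
  | .wuntil ψ₁ ψ₂ => fun i => vac Tr i ∨
      ((∃ j : ℕ, i ≤ j ∧ BodySat Tr ψ₂ j ∧ ∀ k : ℕ, i ≤ k → k < j → BodySat Tr ψ₁ k) ∨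
        ∀ j : ℕ, i ≤ j → BodySat Tr ψ₁ j)

/-- HyperLTL formulas: a quantifier prefix over trace variables followed by an
LTL body; `HyperLTL X n` has `n` already-bound (outer) trace variables. -/
inductive HyperLTL (X : Type) : ℕ → Type 1 where
  | body {n : ℕ} (ψ : LTLBody X n) : HyperLTL X n
  | uall {n : ℕ} (φ : HyperLTL X (n + 1)) : HyperLTL X n
  | uex {n : ℕ} (φ : HyperLTL X (n + 1)) : HyperLTL X n

/-- HyperLTL satisfaction `Π, 0 ⊨_T φ`, with quantifiers ranging over `T`. -/
def HSat {X : Type} (T : Set (Trace X)) :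
    {n : ℕ} → HyperLTL X n → (Fin n → Trace X) → Prop
  | _, .body ψ, Tr => BodySat Tr ψ 0
  | _, .uall φ, Tr => ∀ t ∈ T, HSat T φ (Fin.snoc Tr t)
  | _, .uex φ, Tr => ∃ t ∈ T, HSat T φ (Fin.snoc Tr t)

/-- `P ⊨ φ`, i.e., `∅, 0 ⊨_{Traces(P)} φ`. -/
def Sat {X : Type} [DecidableEq X] (P : Prog X) (φ : HyperLTL X 0) : Prop :=
  HSat (Traces P) φ Fin.elim0

/-- The formula is a `∀*` formula (all quantifiers universal). -/
def IsUniv {X : Type} : {n : ℕ} → HyperLTL X n → Prop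
  | _, .body _ => True
  | _, .uall φ => IsUniv φ
  | _, .uex _ => False

/-- The formula is an `∃*` formula (all quantifiers existential). -/
def IsExist {X : Type} : {n : ℕ} → HyperLTL X n → Prop
  | _, .body _ => True
  | _, .uall _ => False
  | _, .uex φ => IsExist φ

/-- Satisfaction of the `∀ⁿ` HyperLTL formula `∀π₁…∀πₙ. ψ` by program `P`. -/
def SatAll {X : Type} [DecidableEq X] (P : Prog X) {n : ℕ} (ψ : LTLBody X n) : Prop :=
  ∀ Tr : Fin n → Trace X, (∀ j, Tr j ∈ Traces P) → BodySat Tr ψ 0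

/-! ### The encodings -/

/-- The encoding `enc^φ_Ps`: each trace quantifier is resolved on the symbolic
paths in `Ps` (introducing a fresh copy of the program variables, i.e., a store,
and asserting the path condition on it); the body case asserts `acc^ψ_Δ`,
i.e., that the instantiated symbolic observation sequences satisfy `ψ`. -/
def enc {X : Type} (Ps : Set (SymPath X)) :
    {n : ℕ} → HyperLTL X n → (Fin n → Store X) → (Fin n → List (SymStore X)) → Prop
  | _, .body ψ, v, Δ => BodySat (fun j => evalTrace (Δ j) (v j)) ψ 0
  | _, .uall φ, v, Δ => ∀ σ : Store X, ∀ p ∈ Ps, p.1 σ →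
      enc Ps φ (Fin.snoc v σ) (Fin.snoc Δ p.2)
  | _, .uex φ, v, Δ => ∃ σ : Store X, ∃ p ∈ Ps, p.1 σ ∧
      enc Ps φ (Fin.snoc v σ) (Fin.snoc Δ p.2)

/-- The encoding `enc^φ_Ps` for the `∀ⁿ` formula `∀π₁…∀πₙ. ψ`. -/
def encAll {X : Type} {n : ℕ} (ψ : LTLBody X n) (Ps : Set (SymPath X)) : Prop :=
  ∀ (σs : Fin n → Store X) (ps : Fin n → SymPath X),
    (∀ j, ps j ∈ Ps) → (∀ j, (ps j).1 (σs j)) →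
    BodySat (fun j => evalTrace (ps j).2 (σs j)) ψ 0

/-- `t ≠_{X_out} t'`: at some position within both sequences the stores
differ on some output variable. -/
def OutDiff {X : Type} (Xout : Set X) (t t' : Trace X) : Prop :=
  ∃ i : ℕ, (i : ℕ∞) < t.len ∧ (i : ℕ∞) < t'.len ∧ ∃ x ∈ Xout, t.get i x ≠ t'.get i x

/-- `Q` is a fully transparent repair of `(P, ∀π₁…∀πₙ. ψ)`. -/
def FullyTransparent {X : Type} [DecidableEq X] (Xout : Set X) {n : ℕ}
    (ψ : LTLBody X n) (P Q : Prog X) : Prop :=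
  SatAll Q ψ ∧
  ∀ σ : Store X, OutDiff Xout (obsTrace P σ) (obsTrace Q σ) →
    ∃ σs : Fin n → Store X, (∃ j, σ = σs j) ∧
      ¬ BodySat (fun j => obsTrace P (σs j)) ψ 0

/-- `Q` is a better repair than `S` w.r.t. `(P, φ)`. -/
def BetterRepair {X : Type} [DecidableEq X] (Xout : Set X) (φ : HyperLTL X 0)
    (P Q S : Prog X) : Prop :=
  Sat Q φ ∧
  (∀ σ : Store X, OutDiff Xout (obsTrace P σ) (obsTrace Q σ) →
      OutDiff Xout (obsTrace P σ) (obsTrace S σ)) ∧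
  (∃ σ : Store X, OutDiff Xout (obsTrace P σ) (obsTrace S σ) ∧
      ¬ OutDiff Xout (obsTrace P σ) (obsTrace Q σ))

/-- The encoding `trans^φ_{Ps_P, Ps_Q}` for fully transparent repair
(for `φ = ∀π₁…∀πₙ. ψ`). -/
def transEnc {X : Type} (Xout : Set X) {n : ℕ} (ψ : LTLBody X n)
    (PP PQ : Set (SymPath X)) : Prop :=
  ∀ σ : Store X,
    (∃ pP ∈ PP, ∃ pQ ∈ PQ, pP.1 σ ∧ pQ.1 σ ∧
      ∃ i < min pP.2.length pQ.2.length, ∃ x ∈ Xout,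
        (pP.2.getD i initSym) x σ ≠ (pQ.2.getD i initSym) x σ) →
    ∃ (σs : Fin n → Store X) (ps : Fin n → SymPath X),
      (∀ j, ps j ∈ PP) ∧ (∀ j, (ps j).1 (σs j)) ∧ (∃ j, σ = σs j) ∧
      ¬ BodySat (fun j => evalTrace (ps j).2 (σs j)) ψ 0

/-- The encoding `iter_{Ps_P, Ps_S, Ps_Q}` for iterative repair. -/
def iterEnc {X : Type} (Xout : Set X) (PP PS PQ : Set (SymPath X)) : Prop :=
  (∀ σ : Store X, ∀ pP ∈ PP, ∀ pS ∈ PS, ∀ pQ ∈ PQ,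
    pP.1 σ → pS.1 σ → pQ.1 σ →
    (∃ i < min pP.2.length pQ.2.length, ∃ x ∈ Xout,
        (pP.2.getD i initSym) x σ ≠ (pQ.2.getD i initSym) x σ) →
    (∃ i < min pP.2.length pS.2.length, ∃ x ∈ Xout,
        (pP.2.getD i initSym) x σ ≠ (pS.2.getD i initSym) x σ)) ∧
  (∃ σ : Store X, ∃ pP ∈ PP, ∃ pS ∈ PS, ∃ pQ ∈ PQ,
    pP.1 σ ∧ pS.1 σ ∧ pQ.1 σ ∧
    (∃ i < min pP.2.length pS.2.length, ∃ x ∈ Xout,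
        (pP.2.getD i initSym) x σ ≠ (pS.2.getD i initSym) x σ) ∧
    (∀ i < min pP.2.length pQ.2.length, ∀ x ∈ Xout,
        (pP.2.getD i initSym) x σ = (pQ.2.getD i initSym) x σ))

/-- A program is loop-free if it contains no `while` statement. -/
def LoopFree {X : Type} : Prog X → Prop
  | .skip => True
  | .assign _ _ => True
  | .observe => True
  | .ite _ p q => LoopFree p ∧ LoopFree q
  | .whileLoop _ _ => False
  | .seq p q => LoopFree p ∧ LoopFree q

/-! ### Concrete executions -/

theorem filterMap_range_nth {A : Type*} (lbl : ℕ → Option A) (p : ℕ → Prop) [DecidablePred p] (n : ℕ)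
    (hp : ∀ i, p i ↔ i < n ∧ (lbl i).isSome) (d : A) (m : ℕ) (hm : m ≤ n) :
    ((List.range m).filterMap lbl).length = Nat.count p m ∧
      ∀ k (hk : k < ((List.range m).filterMap lbl).length),
        (lbl (Nat.nth p k)).getD d = ((List.range m).filterMap lbl)[k] := by
  induction m with
  | zero => simp
  | succ m ih =>
    obtain ⟨hlen, hget⟩ := ih (by omega)
    cases hl : lbl m with
    | none =>
      have hpm : ¬ p m := by simp [hp, hl]
      simp only [List.range_succ, List.filterMap_append, List.filterMap_cons, List.filterMap_nil,
        hl, List.append_nil, Nat.count_succ, if_neg hpm, Nat.add_zero]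
      exact ⟨hlen, hget⟩
    | some s =>
      have hpm : p m := by simp [hp, hl]; omega
      have hL : (List.range (m + 1)).filterMap lbl = (List.range m).filterMap lbl ++ [s] := by
        simp [List.range_succ, hl]
      simp only [hL, List.length_append, List.length_singleton, Nat.count_succ, if_pos hpm, hlen,
        true_and]
      intro k hk
      by_cases hk' : k < ((List.range m).filterMap lbl).length
      · rw [List.getElem_append_left hk']
        exact hget k hk'
      · obtain rfl : k = Nat.count p m := by omega
        rw [List.getElem_append_right (by omega), Nat.nth_count hpm]
        simp [hl]

section Concrete

variable {X : Type} [DecidableEq X]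

theorem Step.deterministic {C D D' : Config X} {l l' : Option (Store X)}
    (h : Step C l D) (h' : Step C l' D') : l = l' ∧ D = D' := by
  induction h generalizing l' D' with
  | seqSkip =>
    cases h' with
    | seqSkip => exact ⟨rfl, rfl⟩
    | seqStep h => cases h
  | seqStep h ih =>
    cases h' with
    | seqSkip => cases h
    | seqStep h' =>
      obtain ⟨rfl, h⟩ := ih h'
      cases h
      exact ⟨rfl, rfl⟩
  | _ => cases h' <;> simp_all

theorem Step.exists_of_ne_skip (P : Prog X) (σ : Store X) (hP : P ≠ .skip) :
    ∃ l D, Step (P, σ) l D := by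
  induction P with
  | skip => exact absurd rfl hP
  | assign x e => exact ⟨_, _, .assign⟩
  | observe => exact ⟨_, _, .observe⟩
  | ite b p q =>
    cases h : b σ
    · exact ⟨_, _, .iteFalse h⟩
    · exact ⟨_, _, .iteTrue h⟩
  | whileLoop b p =>
    cases h : b σ
    · exact ⟨_, _, .whileFalse h⟩
    · exact ⟨_, _, .whileTrue h⟩
  | seq p q ihp =>
    by_cases hp : p = .skip
    · subst hp
      exact ⟨_, _, .seqSkip⟩
    · obtain ⟨l, ⟨p', σ'⟩, h⟩ := ihp hp
      exact ⟨_, _, .seqStep h⟩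

/-- `Run C L`: execution from `C` reaches `skip`, observing the list `L` of stores. -/
inductive Run : Config X → List (Store X) → Prop where
  | done {σ : Store X} : Run (.skip, σ) []
  | step {C D : Config X} {l : Option (Store X)} {L : List (Store X)}
      (h : Step C l D) (hD : Run D L) : Run C (l.toList ++ L)

theorem Run.deterministic {C : Config X} {L L' : List (Store X)} (h : Run C L)
    (h' : Run C L') : L = L' := by
  induction h generalizing L' with
  | done =>
    cases h' with
    | done => rfl
    | step h _ => cases h
  | step h hD ih =>
    cases h' with
    | done => cases h
    | step h' hD' =>
      obtain ⟨rfl, rfl⟩ := h.deterministic h'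
      rw [ih hD']

theorem Exec.exists_maximal (C : Config X) : ∃ ρ : Exec C, ρ.Maximal := by
  have hnext : ∀ D : Config X, ∃ E : Option (Store X) × Config X,
      D.1 ≠ .skip → Step D E.1 E.2 := by
    rintro ⟨P, σ⟩
    by_cases hP : P = .skip
    · exact ⟨(none, (P, σ)), fun h => absurd hP h⟩
    · obtain ⟨l, D, h⟩ := Step.exists_of_ne_skip P σ hP
      exact ⟨(l, D), fun _ => h⟩
  choose next hnext using hnext
  let cfg : ℕ → Config X := fun n => (fun D => (next D).2)^[n] C
  have hcfg : ∀ i, (cfg i).1 ≠ .skip → Step (cfg i) (next (cfg i)).1 (cfg (i + 1)) := by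
    intro i hi
    have := hnext _ hi
    simpa only [cfg, Function.iterate_succ_apply'] using this
  classical
  by_cases hex : ∃ n, (cfg n).1 = .skip
  · refine ⟨⟨(Nat.find hex : ℕ), cfg, fun i => (next (cfg i)).1, rfl, fun i hi => hcfg i ?_⟩,
      Or.inr ⟨_, rfl, Nat.find_spec hex⟩⟩
    have hi' : i + 1 ≤ Nat.find hex := by exact_mod_cast hi
    exact Nat.find_min hex hi'
  · exact ⟨⟨⊤, cfg, fun i => (next (cfg i)).1, rfl, fun i _ => hcfg i fun h => hex ⟨i, h⟩⟩,
      Or.inl rfl⟩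

/-- The finite trace given by a list of stores. -/
def Trace.Represents (t : Trace X) (L : List (Store X)) : Prop :=
  t.len = L.length ∧ ∀ k (hk : k < L.length), t.get k = L[k]

theorem Exec.run_of_len_eq {C : Config X} (ρ : Exec C) {n : ℕ} (hn : ρ.len = n)
    (hskip : (ρ.cfg n).1 = .skip) : Run C ((List.range n).filterMap ρ.lbl) := by
  have key : ∀ d m, m + d = n → Run (ρ.cfg m) ((List.range' m d).filterMap ρ.lbl) := by
    intro d
    induction d with
    | zero =>
      rintro m rfl
      generalize ρ.cfg m = D at hskip ⊢
      obtain ⟨p, s⟩ := D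
      dsimp only at hskip
      subst hskip
      exact .done
    | succ d ih =>
      intro m hm
      have hstep := ρ.step m (by rw [hn]; exact_mod_cast (by omega : m + 1 ≤ n))
      have := Run.step hstep (ih (m + 1) (by omega))
      rw [List.range'_succ, List.filterMap_cons]
      cases hl : ρ.lbl m <;> simpa [hl] using this
  have := key n 0 (by simp)
  rwa [ρ.init, ← List.range_eq_range'] at this

theorem Exec.obs_represents {C : Config X} (ρ : Exec C) {n : ℕ} (hn : ρ.len = n) :
    ρ.obs.Represents ((List.range n).filterMap ρ.lbl) := by
  classical
  have hp : ∀ i, ρ.ObsIdx i ↔ i < n ∧ (ρ.lbl i).isSome := by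
    intro i
    unfold Exec.ObsIdx
    rw [hn]
    refine and_congr_left fun _ => ?_
    rw [← Nat.succ_le_iff]
    exact_mod_cast Iff.rfl
  obtain ⟨hlen, hget⟩ := filterMap_range_nth ρ.lbl ρ.ObsIdx n hp (fun _ => 0) n le_rfl
  refine ⟨?_, hget⟩
  have hset : {i | ρ.ObsIdx i} = ↑((Finset.range n).filter ρ.ObsIdx) := by
    ext i
    simp only [Set.mem_ofPred_eq, Finset.coe_filter, Finset.mem_range]
    exact ⟨fun h => ⟨((hp i).1 h).1, h⟩, fun h => h.2⟩
  have hfin : {i | ρ.ObsIdx i}.Finite := hset ▸ Finset.finite_toSet _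
  simp only [Exec.obs]
  rw [dif_pos hfin, hlen, Nat.count_eq_card_filter_range]
  congr 2
  ext i
  simp [hp]

theorem Exec.exists_run {P : Prog X} (hP : Terminating P) {σ : Store X} (ρ : Exec (P, σ))
    (hρ : ρ.Maximal) : ∃ L, Run (P, σ) L ∧ ρ.obs.Represents L := by
  obtain ⟨n, hn⟩ := hP σ ρ hρ
  refine ⟨_, ρ.run_of_len_eq hn ?_, ρ.obs_represents hn⟩
  rcases hρ with h | ⟨m, hm, hskip⟩
  · simp [hn] at h
  · obtain rfl : n = m := by exact_mod_cast hn.symm.trans hm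
    exact hskip

end Concrete

/-! ### Correspondence with symbolic execution -/

section Symbolic

variable {X : Type} [DecidableEq X]

theorem eval_update_symEvalA (ν : SymStore X) (x : X) (e : Store X → ℤ) (σ : Store X) :
    (fun y => Function.update ν x (symEvalA e ν) y σ) =
      Function.update (fun y => ν y σ) x (e fun y => ν y σ) := by
  funext y
  by_cases hy : y = x
  · subst hy
    simp [symEvalA]
  · simp [hy]

theorem SymStep.sound {C D : SymConfig X} (h : SymStep C D) {σ : Store X} (hD : D.2.2.1 σ) :
    C.2.2.1 σ ∧ ∃ l, Step (C.1, fun x => C.2.1 x σ) l (D.1, fun x => D.2.1 x σ) ∧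
      evalObs D.2.2.2 σ = evalObs C.2.2.2 σ ++ l.toList := by
  induction h with
  | @assign x e ν α β =>
    refine ⟨hD, none, ?_, by simp⟩
    rw [eval_update_symEvalA]
    exact .assign
  | observe => exact ⟨hD, _, .observe, by simp [evalObs]⟩
  | iteTrue => exact ⟨hD.1, none, .iteTrue hD.2, by simp⟩
  | iteFalse => exact ⟨hD.1, none, .iteFalse hD.2, by simp⟩
  | whileTrue => exact ⟨hD.1, none, .whileTrue hD.2, by simp⟩
  | whileFalse => exact ⟨hD.1, none, .whileFalse hD.2, by simp⟩
  | seqSkip => exact ⟨hD, none, .seqSkip, by simp⟩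
  | seqStep h ih =>
    obtain ⟨hC, l, hl, hobs⟩ := ih hD
    exact ⟨hC, l, .seqStep hl, hobs⟩

theorem SymStep.run_of_reflTransGen {C D : SymConfig X} (h : Relation.ReflTransGen SymStep C D)
    (hskip : D.1 = .skip) {σ : Store X} (hD : D.2.2.1 σ) :
    C.2.2.1 σ ∧ ∃ L, Run (C.1, fun x => C.2.1 x σ) L ∧
      evalObs D.2.2.2 σ = evalObs C.2.2.2 σ ++ L := by
  induction h using Relation.ReflTransGen.head_induction_on with
  | refl => exact ⟨hD, [], hskip ▸ .done, by simp⟩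
  | head hstep _ ih =>
    obtain ⟨hC', L, hL, hobs'⟩ := ih
    obtain ⟨hC, l, hl, hobs⟩ := hstep.sound hC'
    exact ⟨hC, _, .step hl hL, by rw [hobs', hobs, List.append_assoc]⟩

theorem SymStep.complete {C D : Config X} {l : Option (Store X)} (h : Step C l D) {σ : Store X}
    {ν : SymStore X} {α : PathCond X} (β : List (SymStore X)) (hν : C.2 = fun x => ν x σ)
    (hα : α σ) :
    ∃ ν' α' β', SymStep (C.1, ν, α, β) (D.1, ν', α', β') ∧ (D.2 = fun x => ν' x σ) ∧ α' σ := by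
  induction h with
  | @assign x e s =>
    dsimp only at hν
    subst hν
    exact ⟨_, _, _, .assign, (eval_update_symEvalA ν x e σ).symm, hα⟩
  | observe => exact ⟨_, _, _, .observe, hν, hα⟩
  | iteTrue h => exact ⟨_, _, _, .iteTrue, hν, hα, by simpa [symEvalB, ← hν] using h⟩
  | iteFalse h => exact ⟨_, _, _, .iteFalse, hν, hα, by simpa [symEvalB, ← hν] using h⟩
  | whileTrue h => exact ⟨_, _, _, .whileTrue, hν, hα, by simpa [symEvalB, ← hν] using h⟩
  | whileFalse h => exact ⟨_, _, _, .whileFalse, hν, hα, by simpa [symEvalB, ← hν] using h⟩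
  | seqSkip => exact ⟨_, _, _, .seqSkip, hν, hα⟩
  | seqStep _ ih =>
    obtain ⟨ν', α', β', h, hν', hα'⟩ := ih hν
    exact ⟨ν', α', β', .seqStep h, hν', hα'⟩

theorem Run.exists_reflTransGen {C : Config X} {L : List (Store X)} (h : Run C L) {σ : Store X}
    {ν : SymStore X} {α : PathCond X} (β : List (SymStore X)) (hν : C.2 = fun x => ν x σ)
    (hα : α σ) :
    ∃ ν' α' β', Relation.ReflTransGen SymStep (C.1, ν, α, β) (.skip, ν', α', β') ∧ α' σ := by
  induction h generalizing ν α β with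
  | done => exact ⟨_, _, _, .refl, hα⟩
  | step hstep _ ih =>
    obtain ⟨ν', α', β', hs, hν', hα'⟩ := SymStep.complete hstep β hν hα
    obtain ⟨ν'', α'', β'', hss, hα''⟩ := ih β' hν' hα'
    exact ⟨ν'', α'', β'', .head hs hss, hα''⟩

theorem run_evalObs_of_mem_symPathsMax {P : Prog X} {p : SymPath X} (hp : p ∈ SymPathsMax P)
    {σ : Store X} (hσ : p.1 σ) : Run (P, σ) (evalObs p.2 σ) := by
  obtain ⟨⟨ν, hν⟩, -⟩ := hp
  obtain ⟨-, L, hL, hobs⟩ := SymStep.run_of_reflTransGen hν rfl hσ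
  obtain rfl : evalObs p.2 σ = L := by simpa [evalObs] using hobs
  exact hL

theorem exists_mem_symPathsMax {P : Prog X} (hP : Terminating P) (σ : Store X) :
    ∃ p ∈ SymPathsMax P, p.1 σ := by
  obtain ⟨ρ, hρ⟩ := Exec.exists_maximal (P, σ)
  obtain ⟨L, hL, -⟩ := ρ.exists_run hP hρ
  obtain ⟨ν, α, β, h, hα⟩ :=
    hL.exists_reflTransGen (σ := σ) (ν := initSym) (α := fun _ => True) [] rfl trivial
  exact ⟨(α, β), ⟨⟨ν, h⟩, σ, hα⟩, hα⟩

/-- Two traces agree if they have the same length and the same stores within it. -/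
def Trace.Agrees (t t' : Trace X) : Prop :=
  t.len = t'.len ∧ ∀ i : ℕ, (i : ℕ∞) < t.len → t.get i = t'.get i

theorem Exec.obs_agrees_evalTrace {P : Prog X} (hP : Terminating P) {σ : Store X}
    (ρ : Exec (P, σ)) (hρ : ρ.Maximal) {p : SymPath X} (hp : p ∈ SymPathsMax P) (hσ : p.1 σ) :
    ρ.obs.Agrees (evalTrace p.2 σ) := by
  obtain ⟨L, hL, hlen, hget⟩ := ρ.exists_run hP hρ
  obtain rfl := hL.deterministic (run_evalObs_of_mem_symPathsMax hp hσ)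
  refine ⟨by simpa [evalTrace, evalObs] using hlen, fun i hi => ?_⟩
  rw [hlen] at hi
  have hi' : i < (evalObs p.2 σ).length := by exact_mod_cast hi
  rw [hget i hi']
  have hi'' : i < p.2.length := by simpa [evalObs] using hi'
  simp [evalObs, evalTrace, hi'']

theorem obsTrace_agrees_evalTrace {P : Prog X} (hP : Terminating P) {σ : Store X}
    {p : SymPath X} (hp : p ∈ SymPathsMax P) (hσ : p.1 σ) :
    (obsTrace P σ).Agrees (evalTrace p.2 σ) := by
  have h := Exec.exists_maximal (P, σ)
  rw [obsTrace, dif_pos h]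
  exact Exec.obs_agrees_evalTrace hP _ h.choose_spec hp hσ

end Symbolic

/-! ### Encodings -/

section Encoding

variable {X : Type}

theorem vac_congr {n : ℕ} {Tr Tr' : Fin n → Trace X} (h : ∀ j, (Tr j).Agrees (Tr' j)) (i : ℕ) :
    vac Tr i ↔ vac Tr' i := by
  simp only [vac, fun j => (h j).1]

theorem bodySat_congr {n : ℕ} {Tr Tr' : Fin n → Trace X} (h : ∀ j, (Tr j).Agrees (Tr' j))
    (ψ : LTLBody X n) (i : ℕ) : BodySat Tr ψ i ↔ BodySat Tr' ψ i := by
  induction ψ generalizing i with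
  | atom θ =>
    simp only [BodySat, ← vac_congr h]
    by_cases hv : vac Tr i
    · simp [hv]
    · have hget : ∀ j, (Tr j).get i = (Tr' j).get i := fun j =>
        (h j).2 i (not_le.1 fun hj => hv ⟨j, hj⟩)
      simp only [hget]
  | and ψ₁ ψ₂ ih₁ ih₂ => simp only [BodySat, vac_congr h, ih₁, ih₂]
  | or ψ₁ ψ₂ ih₁ ih₂ => simp only [BodySat, vac_congr h, ih₁, ih₂]
  | next ψ ih => simp only [BodySat, vac_congr h, ih]
  | wuntil ψ₁ ψ₂ ih₁ ih₂ => simp only [BodySat, vac_congr h, ih₁, ih₂]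

theorem outDiff_congr {Xout : Set X} {t₁ t₂ t₁' t₂' : Trace X} (h₁ : t₁.Agrees t₁')
    (h₂ : t₂.Agrees t₂') : OutDiff Xout t₁ t₂ ↔ OutDiff Xout t₁' t₂' := by
  unfold OutDiff
  refine exists_congr fun i => ?_
  rw [← h₁.1, ← h₂.1]
  refine and_congr_right fun hi₁ => and_congr_right fun hi₂ => ?_
  rw [h₁.2 i hi₁, h₂.2 i hi₂]

theorem outDiff_evalTrace {Xout : Set X} {β β' : List (SymStore X)} {σ : Store X} :
    OutDiff Xout (evalTrace β σ) (evalTrace β' σ) ↔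
      ∃ i < min β.length β'.length, ∃ x ∈ Xout,
        (β.getD i initSym) x σ ≠ (β'.getD i initSym) x σ := by
  simp only [OutDiff, evalTrace, Nat.cast_lt, lt_min_iff, and_assoc]

theorem agrees_snoc {n : ℕ} {Tr : Fin n → Trace X} {v : Fin n → Store X}
    {Δ : Fin n → List (SymStore X)} (h : ∀ j, (Tr j).Agrees (evalTrace (Δ j) (v j)))
    {t : Trace X} {σ : Store X} {β : List (SymStore X)} (ht : t.Agrees (evalTrace β σ))
    (j : Fin (n + 1)) :
    (Fin.snoc (α := fun _ => Trace X) Tr t j).Agrees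
      (evalTrace (Fin.snoc (α := fun _ => List (SymStore X)) Δ β j)
        (Fin.snoc (α := fun _ => Store X) v σ j)) := by
  induction j using Fin.lastCases with
  | last => simpa using ht
  | cast j => simpa using h j

theorem hSat_traces_iff_enc [DecidableEq X] {P : Prog X} (hP : Terminating P) {n : ℕ}
    (φ : HyperLTL X n) {Tr : Fin n → Trace X} {v : Fin n → Store X}
    {Δ : Fin n → List (SymStore X)} (h : ∀ j, (Tr j).Agrees (evalTrace (Δ j) (v j))) :
    HSat (Traces P) φ Tr ↔ enc (SymPathsMax P) φ v Δ := by
  induction φ with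
  | body ψ => exact bodySat_congr h ψ 0
  | uall φ ih =>
    simp only [HSat, enc]
    constructor
    · intro hall σ p hp hσ
      obtain ⟨ρ, hρ⟩ := Exec.exists_maximal (P, σ)
      exact (ih (agrees_snoc h (ρ.obs_agrees_evalTrace hP hρ hp hσ))).1 (hall _ ⟨σ, ρ, hρ, rfl⟩)
    · rintro hall t ⟨σ, ρ, hρ, rfl⟩
      obtain ⟨p, hp, hσ⟩ := exists_mem_symPathsMax hP σ
      exact (ih (agrees_snoc h (ρ.obs_agrees_evalTrace hP hρ hp hσ))).2 (hall σ p hp hσ)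
  | uex φ ih =>
    simp only [HSat, enc]
    constructor
    · rintro ⟨t, ⟨σ, ρ, hρ, rfl⟩, ht⟩
      obtain ⟨p, hp, hσ⟩ := exists_mem_symPathsMax hP σ
      exact ⟨σ, p, hp, hσ, (ih (agrees_snoc h (ρ.obs_agrees_evalTrace hP hρ hp hσ))).1 ht⟩
    · rintro ⟨σ, p, hp, hσ, henc⟩
      obtain ⟨ρ, hρ⟩ := Exec.exists_maximal (P, σ)
      exact ⟨_, ⟨σ, ρ, hρ, rfl⟩,
        (ih (agrees_snoc h (ρ.obs_agrees_evalTrace hP hρ hp hσ))).2 henc⟩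

theorem outDiff_obsTrace_iff [DecidableEq X] {Xout : Set X} {P Q : Prog X} (hP : Terminating P)
    (hQ : Terminating Q) {σ : Store X} {p q : SymPath X} (hp : p ∈ SymPathsMax P)
    (hpσ : p.1 σ) (hq : q ∈ SymPathsMax Q) (hqσ : q.1 σ) :
    OutDiff Xout (obsTrace P σ) (obsTrace Q σ) ↔
      ∃ i < min p.2.length q.2.length, ∃ x ∈ Xout,
        (p.2.getD i initSym) x σ ≠ (q.2.getD i initSym) x σ :=
  (outDiff_congr (obsTrace_agrees_evalTrace hP hp hpσ)
    (obsTrace_agrees_evalTrace hQ hq hqσ)).trans outDiff_evalTrace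

end Encoding

/-- Proposition on iterative repair. For a HyperLTL formula
`φ` and terminating programs `P, Q, S` with finite sets of satisfiable maximal
symbolic paths, `Q` is a better repair than `S` w.r.t. `(P, φ)` iff
`enc^φ_{SymPaths_max(Q)} ∧ iter_{SymPaths_max(P), SymPaths_max(S), SymPaths_max(Q)}`
is valid. -/
theorem iterative_repair_encoding {X : Type} [DecidableEq X] (Xout : Set X)
    (φ : HyperLTL X 0) (P Q S : Prog X)
    (htP : Terminating P) (htS : Terminating S) (htQ : Terminating Q)
    (hfP : (SymPathsMax P).Finite) (hfS : (SymPathsMax S).Finite)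
    (hfQ : (SymPathsMax Q).Finite) :
    BetterRepair Xout φ P Q S ↔
      (enc (SymPathsMax Q) φ Fin.elim0 Fin.elim0 ∧
        iterEnc Xout (SymPathsMax P) (SymPathsMax S) (SymPathsMax Q)) := by
  refine and_congr (hSat_traces_iff_enc htQ φ fun j => j.elim0) (and_congr ?_ ?_)
  · constructor
    · intro h σ pP hP pS hS pQ hQ hPσ hSσ hQσ hdiff
      exact (outDiff_obsTrace_iff htP htS hP hPσ hS hSσ).1
        (h σ ((outDiff_obsTrace_iff htP htQ hP hPσ hQ hQσ).2 hdiff))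
    · intro h σ hdiff
      obtain ⟨pP, hP, hPσ⟩ := exists_mem_symPathsMax htP σ
      obtain ⟨pS, hS, hSσ⟩ := exists_mem_symPathsMax htS σ
      obtain ⟨pQ, hQ, hQσ⟩ := exists_mem_symPathsMax htQ σ
      exact (outDiff_obsTrace_iff htP htS hP hPσ hS hSσ).2
        (h σ pP hP pS hS pQ hQ hPσ hSσ hQσ
          ((outDiff_obsTrace_iff htP htQ hP hPσ hQ hQσ).1 hdiff))
  · refine exists_congr fun σ => ⟨?_, ?_⟩
    · rintro ⟨hdiff, hsame⟩
      obtain ⟨pP, hP, hPσ⟩ := exists_mem_symPathsMax htP σ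
      obtain ⟨pS, hS, hSσ⟩ := exists_mem_symPathsMax htS σ
      obtain ⟨pQ, hQ, hQσ⟩ := exists_mem_symPathsMax htQ σ
      rw [outDiff_obsTrace_iff htP htQ hP hPσ hQ hQσ] at hsame
      push Not at hsame
      exact ⟨pP, hP, pS, hS, pQ, hQ, hPσ, hSσ, hQσ,
        (outDiff_obsTrace_iff htP htS hP hPσ hS hSσ).1 hdiff, hsame⟩
    · rintro ⟨pP, hP, pS, hS, pQ, hQ, hPσ, hSσ, hQσ, hdiff, hsame⟩
      refine ⟨(outDiff_obsTrace_iff htP htS hP hPσ hS hSσ).2 hdiff, ?_⟩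
      rw [outDiff_obsTrace_iff htP htQ hP hPσ hQ hQσ]
      push Not
      exact hsame

end HyRep
end

section
/- (Correctness of the acceptance encoding.) Let A = (Q, Q₀, δ) be a nondeterministic safety automaton over the alphabet 2^F for a finite set F of atomic predicates over indexed variables, let Δ assign to each trace variable π₁,…,πₙ a finite sequence of symbolic stores, let m = min over j of |Δ(πⱼ)|, and let v be a valuation of the indexed integer variables x_{πⱼ}. Define the word u ∈ (2^F)^m by u(i) = {θ ∈ F : v satisfies θ[x_{πⱼ} / (Δ(πⱼ)(i)(x) with every variable y replaced by y_{πⱼ})]}. Then v satisfies the formula acc_Δ (defined by acc_Δ = ⋁_{q ∈ Q₀} acc_Δ^{q,0}, where acc_Δ^{q,i} = true if i ≥ m, and otherwise acc_Δ^{q,i} = ⋁_{(q,ι,q') ∈ δ} ( acc_Δ^{q',i+1} ∧ ⋀_{θ ∈ ι} θ[substituted as above] ∧ ⋀_{θ ∈ F \ ι} ¬θ[substituted as above] )) if and only if A has a run on u. -/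
namespace NSAEnc

/-- A (concrete) store maps program variables to integers. -/
abbrev Store (X : Type) := X → ℤ

/-- A symbolic store maps each variable to an integer expression over `X`. -/
abbrev SymStore (X : Type) := X → Store X → ℤ

/-- The identity symbolic store (used as a default list entry). -/
def initSym {X : Type} : SymStore X := fun x σ => σ x

/-- `accSteps δ holds k i q` is the formula `acc_Δ^{q,i}` (shallowly embedded,
with `k` the number of remaining steps, i.e., `k = m - i`): it is `True` when
no steps remain (`i ≥ m`), and otherwise demands a transition `(q, ι, q') ∈ δ`
whose label `ι` matches exactly the atomic predicates that hold at step `i`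
(under the instantiated symbolic stores) and such that `acc_Δ^{q', i+1}`. -/
def accSteps {Q F : Type} (δ : Set (Q × Set F × Q)) (holds : F → ℕ → Prop) :
    ℕ → ℕ → Q → Prop
  | 0, _, _ => True
  | k + 1, i, q =>
      ∃ t ∈ δ, t.1 = q ∧ (∀ θ ∈ t.2.1, holds θ i) ∧
        (∀ θ, θ ∉ t.2.1 → ¬ holds θ i) ∧ accSteps δ holds k (i + 1) t.2.2

theorem setOf_holds_eq_iff {F : Type} (holds : F → ℕ → Prop) (i : ℕ) (ι : Set F) :
    ι = {θ | holds θ i} ↔ (∀ θ ∈ ι, holds θ i) ∧ ∀ θ, θ ∉ ι → ¬ holds θ i := by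
  simp only [Set.ext_iff, Set.mem_ofPred_eq]
  exact ⟨fun h => ⟨fun θ => (h θ).1, fun θ => mt (h θ).2⟩,
    fun h θ => ⟨h.1 θ, fun hθ => by_contra fun hn => h.2 θ hn hθ⟩⟩

theorem accSteps_iff_exists_run {Q F : Type} (δ : Set (Q × Set F × Q))
    (holds : F → ℕ → Prop) (k i : ℕ) (q : Q) :
    accSteps δ holds k i q ↔
      ∃ r : ℕ → Q, r 0 = q ∧ ∀ j < k, (r j, {θ | holds θ (i + j)}, r (j + 1)) ∈ δ := by
  induction k generalizing i q with
  | zero => exact ⟨fun _ => ⟨fun _ => q, rfl, by simp⟩, fun _ => trivial⟩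
  | succ k ih =>
    constructor
    · rintro ⟨⟨p, ι, q'⟩, ht, rfl, hpos, hneg, hacc⟩
      obtain ⟨r, rfl, hr⟩ := (ih _ _).1 hacc
      obtain rfl := (setOf_holds_eq_iff holds i ι).2 ⟨hpos, hneg⟩
      refine ⟨fun j => Nat.casesOn j p r, rfl, ?_⟩
      rintro (_ | j) hj
      · exact ht
      · have h := hr j (by omega)
        rwa [Nat.add_right_comm] at h
    · rintro ⟨r, rfl, hr⟩
      obtain ⟨hpos, hneg⟩ := (setOf_holds_eq_iff holds i _).1 rfl
      refine ⟨_, hr 0 k.succ_pos, rfl, hpos, hneg, (ih _ _).2 ⟨fun j => r (j + 1), rfl, ?_⟩⟩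
      intro j hj
      have h := hr (j + 1) (by omega)
      rwa [← Nat.add_assoc, Nat.add_right_comm] at h

/-- Correctness of the acceptance encoding. Let
`A = (Q, Q₀, δ)` be an NSA over the alphabet `2^F` (`F` a finite set of atomic
predicates over the indexed variables, interpreted by `interp`), let `Δ` assign
to each trace variable a finite sequence of symbolic stores, let `m` be the
minimum of the lengths `|Δ(πⱼ)|`, and let `v` be a valuation of the indexed
variables (one store per trace variable).  Define the word `u ∈ (2^F)^m` by
`u(i) = {θ ∈ F : v satisfies the substituted θ at step i}`.  Then `v` satisfies
the formula `acc_Δ = ⋁_{q ∈ Q₀} acc_Δ^{q,0}` iff `A` has a run on `u`. -/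
theorem acc_encoding_correct {X QS F : Type} [Fintype QS] [Fintype F] {n : ℕ}
    (Q₀ : Set QS) (δ : Set (QS × Set F × QS))
    (interp : F → (Fin n → Store X) → Prop)
    (Δ : Fin n → List (SymStore X)) (v : Fin n → Store X)
    (m : ℕ) (hm : (m : ℕ∞) = Finset.univ.inf fun j : Fin n => ((Δ j).length : ℕ∞)) :
    (∃ q ∈ Q₀,
      accSteps δ
        (fun θ i => interp θ fun j x => ((Δ j).getD i initSym) x (v j)) m 0 q) ↔
    (∃ r : ℕ → QS, r 0 ∈ Q₀ ∧ ∀ i < m,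
      (r i, { θ : F | interp θ fun j x => ((Δ j).getD i initSym) x (v j) },
        r (i + 1)) ∈ δ) := by
  simp only [accSteps_iff_exists_run, Nat.zero_add]
  constructor
  · rintro ⟨_, hq, r, rfl, hr⟩
    exact ⟨r, hq, hr⟩
  · rintro ⟨r, hq, hr⟩
    exact ⟨_, hq, r, rfl, hr⟩

end NSAEnc
end

section
/- Every formula of the syntactic safety fragment of LTL defines a safety property over infinite words: if ψ is built from atomic propositions and their negations using ∧, ∨, the next operator X, and the weak-until operator W (with standard semantics over infinite words w : ℕ → 2^AP), and an infinite word w does not satisfy ψ, then there is a finite prefix of w such that no infinite word extending that prefix satisfies ψ. -/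
namespace SafeLTLSafety

/-- The syntactic safety fragment of LTL: atomic propositions and their
negations, closed under `∧`, `∨`, next `X`, and weak-until `W`. -/
inductive SafeLTL (AP : Type) : Type where
  | pos (a : AP) : SafeLTL AP
  | neg (a : AP) : SafeLTL AP
  | and (ψ₁ ψ₂ : SafeLTL AP) : SafeLTL AP
  | or (ψ₁ ψ₂ : SafeLTL AP) : SafeLTL AP
  | next (ψ : SafeLTL AP) : SafeLTL AP
  | wuntil (ψ₁ ψ₂ : SafeLTL AP) : SafeLTL AP

/-- Standard LTL semantics over infinite words `w : ℕ → 2^AP` at position `i`. -/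
def sat {AP : Type} (w : ℕ → Set AP) : SafeLTL AP → ℕ → Prop
  | .pos a => fun i => a ∈ w i
  | .neg a => fun i => a ∉ w i
  | .and ψ₁ ψ₂ => fun i => sat w ψ₁ i ∧ sat w ψ₂ i
  | .or ψ₁ ψ₂ => fun i => sat w ψ₁ i ∨ sat w ψ₂ i
  | .next ψ => fun i => sat w ψ (i + 1)
  | .wuntil ψ₁ ψ₂ => fun i =>
      (∃ j : ℕ, i ≤ j ∧ sat w ψ₂ j ∧ ∀ k : ℕ, i ≤ k → k < j → sat w ψ₁ k) ∨
        ∀ j : ℕ, i ≤ j → sat w ψ₁ j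

open Filter in
/-- If `w` violates `ψ` at position `i`, then all sufficiently long prefixes of `w` force this
violation. -/
theorem eventually_not_sat_of_not_sat {AP : Type} (ψ : SafeLTL AP) (w : ℕ → Set AP) (i : ℕ)
    (h : ¬ sat w ψ i) :
    ∀ᶠ k in atTop, ∀ w' : ℕ → Set AP, (∀ n < k, w' n = w n) → ¬ sat w' ψ i := by
  induction ψ generalizing i with
  | pos a | neg a =>
    filter_upwards [eventually_gt_atTop i] with k hk w' hw'
    simpa only [sat, hw' i hk] using h
  | and ψ₁ ψ₂ ih₁ ih₂ =>
    rcases not_and_or.mp h with h | h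
    · filter_upwards [ih₁ i h] with k hk w' hw' hs using hk w' hw' hs.1
    · filter_upwards [ih₂ i h] with k hk w' hw' hs using hk w' hw' hs.2
  | or ψ₁ ψ₂ ih₁ ih₂ =>
    obtain ⟨h₁, h₂⟩ := not_or.mp h
    filter_upwards [ih₁ i h₁, ih₂ i h₂] with k hk₁ hk₂ w' hw' hs
    exact hs.elim (hk₁ w' hw') (hk₂ w' hw')
  | next ψ ih => exact ih (i + 1) h
  | wuntil ψ₁ ψ₂ ih₁ ih₂ =>
    classical
    obtain ⟨hU, hG⟩ := not_or.mp h
    have hex : ∃ j, i ≤ j ∧ ¬ sat w ψ₁ j := by simpa using hG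
    obtain ⟨hij, hj⟩ := Nat.find_spec hex
    have hmin : ∀ k, i ≤ k → k < Nat.find hex → sat w ψ₁ k := fun k hik hk =>
      by_contra fun hn => Nat.find_min hex hk ⟨hik, hn⟩
    set j := Nat.find hex
    have h₂ : ∀ᶠ k in atTop, ∀ m ∈ Finset.Icc i j, ∀ w' : ℕ → Set AP,
        (∀ n < k, w' n = w n) → ¬ sat w' ψ₂ m := by
      refine (eventually_all_finset _).mpr fun m hm => ih₂ m fun hs => ?_
      obtain ⟨him, hmj⟩ := Finset.mem_Icc.mp hm
      exact hU ⟨m, him, hs, fun k hik hk => hmin k hik (hk.trans_le hmj)⟩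
    filter_upwards [ih₁ j hj, h₂] with k hk₁ hk₂ w' hw' hs
    rcases hs with ⟨m, him, hm, hlt⟩ | hs
    · rcases le_or_gt m j with hmj | hjm
      · exact hk₂ m (Finset.mem_Icc.mpr ⟨him, hmj⟩) w' hw' hm
      · exact hk₁ w' hw' (hlt j hij hjm)
    · exact hk₁ w' hw' (hs j hij)

/-- Every formula of the syntactic safety fragment of LTL
defines a safety property over infinite words: if an infinite word `w` does not
satisfy `ψ`, then there is a finite prefix of `w` (of some length `k`) such that
no infinite word extending that prefix satisfies `ψ`. -/
theorem syntactic_safety_fragment_is_safety {AP : Type} (ψ : SafeLTL AP)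
    (w : ℕ → Set AP) (h : ¬ sat w ψ 0) :
    ∃ k : ℕ, ∀ w' : ℕ → Set AP, (∀ i < k, w' i = w i) → ¬ sat w' ψ 0 := by
  exact (eventually_not_sat_of_not_sat ψ w 0 h).exists

end SafeLTLSafety
end
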